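/- If C takes values μ_i with probabilities c_i and Z ~ N(0, β²I_d) is independent of C, then h(C+Z) ≤ (d/2)log(2πeβ²) − Σ_i c_i log(Σ_j c_j exp(−‖μ_i − μ_j‖²/(2β²))). -/

import Mathlib

open MeasureTheory Real

/-- The density of the Gaussian `N(μ, β²I_d)` on `ℝ^d`. -/
noncomputable def gaussPdf {d : ℕ} (β : ℝ) (μ t : EuclideanSpace ℝ (Fin d)) : ℝ :=
  (2 * π * β ^ 2) ^ (-(d : ℝ) / 2) * Real.exp (-‖t - μ‖ ^ 2 / (2 * β ^ 2))

/-- Differential entropy `h(g) = −∫ g log g` of a density on `ℝ^d`. -/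
noncomputable def diffEnt {d : ℕ} (g : EuclideanSpace ℝ (Fin d) → ℝ) : ℝ :=
  -∫ t, g t * Real.log (g t)

section helpers

variable {d : ℕ}

lemma aux_int0 {b : ℝ} (hb : 0 < b) :
    Integrable (fun x : EuclideanSpace ℝ (Fin d) => Real.exp (-b * ‖x‖ ^ 2)) := by
  have h := GaussianFourier.integrable_cexp_neg_mul_sq_norm_add (V := EuclideanSpace ℝ (Fin d))
    (b := (b : ℂ)) (by simpa using hb) 0 0
  have h2 := h.re
  refine h2.congr (Filter.Eventually.of_forall fun x => ?_)
  have : (-(b : ℂ) * (‖x‖ : ℂ) ^ 2 + 0 * (inner ℝ 0 x : ℝ)) = ((-b * ‖x‖ ^ 2 : ℝ) : ℂ) := by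
    push_cast; ring
  beta_reduce
  rw [this, ← Complex.ofReal_exp]
  exact Complex.ofReal_re _

lemma aux_int2 {b : ℝ} (hb : 0 < b) :
    Integrable (fun x : EuclideanSpace ℝ (Fin d) => ‖x‖ ^ 2 * Real.exp (-b * ‖x‖ ^ 2)) := by
  refine ((aux_int0 (d := d) (half_pos hb)).const_mul (2 / b)).mono' (by fun_prop)
    (Filter.Eventually.of_forall fun x => ?_)
  rw [Real.norm_of_nonneg (by positivity)]
  have e : Real.exp (-b * ‖x‖ ^ 2) = Real.exp (-(b / 2) * ‖x‖ ^ 2) * Real.exp (-(b / 2) * ‖x‖ ^ 2) := by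
    rw [← Real.exp_add]; ring_nf
  have h1 : b / 2 * ‖x‖ ^ 2 * Real.exp (-(b / 2) * ‖x‖ ^ 2) ≤ 1 := by
    have h := Real.add_one_le_exp (b / 2 * ‖x‖ ^ 2)
    rw [neg_mul, Real.exp_neg, mul_inv_le_iff₀ (Real.exp_pos _)]
    linarith
  have h2 : ‖x‖ ^ 2 * Real.exp (-(b / 2) * ‖x‖ ^ 2) ≤ 2 / b := by
    rw [le_div_iff₀ hb]; linarith
  rw [e, ← mul_assoc]
  gcongr

lemma aux_int1 {b : ℝ} (hb : 0 < b) (v : EuclideanSpace ℝ (Fin d)) :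
    Integrable (fun x : EuclideanSpace ℝ (Fin d) => inner ℝ x v * Real.exp (-b * ‖x‖ ^ 2)) := by
  refine ((aux_int2 (d := d) hb).add ((aux_int0 (d := d) hb).const_mul (‖v‖ ^ 2))).mono'
    (by fun_prop) (Filter.Eventually.of_forall fun x => ?_)
  rw [norm_mul, Real.norm_of_nonneg (Real.exp_pos _).le, Real.norm_eq_abs]
  simp only [Pi.add_apply]
  rw [← add_mul]
  gcongr
  have := abs_real_inner_le_norm x v
  nlinarith [sq_nonneg (‖x‖ - ‖v‖), sq_nonneg ‖x‖, sq_nonneg ‖v‖]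

lemma aux_val1 {b : ℝ} (v : EuclideanSpace ℝ (Fin d)) :
    ∫ x : EuclideanSpace ℝ (Fin d), inner ℝ x v * Real.exp (-b * ‖x‖ ^ 2) = 0 := by
  have h := integral_neg_eq_self
    (fun x : EuclideanSpace ℝ (Fin d) => inner ℝ x v * Real.exp (-b * ‖x‖ ^ 2)) volume
  simp only [inner_neg_left, norm_neg, neg_mul, integral_neg] at h ⊢
  linarith

lemma aux_val2 {b : ℝ} (hb : 0 < b) :
    ∫ x : EuclideanSpace ℝ (Fin d), ‖x‖ ^ 2 * Real.exp (-b * ‖x‖ ^ 2) =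
      (d : ℝ) / 2 / b * ∫ x : EuclideanSpace ℝ (Fin d), Real.exp (-b * ‖x‖ ^ 2) := by
  rcases Nat.eq_zero_or_pos d with rfl | hd
  · have : ∀ x : EuclideanSpace ℝ (Fin 0), ‖x‖ = 0 := fun x => by
      rw [Subsingleton.elim x 0, norm_zero]
    simp [this]
  have : Nonempty (Fin d) := ⟨⟨0, hd⟩⟩
  have hd' : (0 : ℝ) < d := by exact_mod_cast hd
  have k := integral_rpow_mul_exp_neg_mul_rpow (p := 2) (q := (d : ℝ) + 1) (b := b)
    (by norm_num) (by linarith) hb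
  have k' := integral_rpow_mul_exp_neg_mul_rpow (p := 2) (q := (d : ℝ) - 1) (b := b)
    (by norm_num) (by linarith) hb
  have e1 : ∫ y in Set.Ioi (0 : ℝ), y ^ (d - 1) * (y ^ 2 * Real.exp (-b * y ^ 2)) =
      ∫ y in Set.Ioi (0 : ℝ), y ^ ((d : ℝ) + 1) * Real.exp (-b * y ^ (2 : ℝ)) := by
    refine setIntegral_congr_fun measurableSet_Ioi fun y hy => ?_
    have : y ^ ((d : ℝ) + 1) = y ^ (d - 1) * y ^ 2 := by
      rw [← pow_add, show d - 1 + 2 = d + 1 by omega]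
      exact_mod_cast Real.rpow_natCast y (d + 1)
    simp only [this, Real.rpow_two, mul_assoc]
  have e2 : ∫ y in Set.Ioi (0 : ℝ), y ^ (d - 1) * (Real.exp (-b * y ^ 2)) =
      ∫ y in Set.Ioi (0 : ℝ), y ^ ((d : ℝ) - 1) * Real.exp (-b * y ^ (2 : ℝ)) := by
    refine setIntegral_congr_fun measurableSet_Ioi fun y hy => ?_
    have : y ^ ((d : ℝ) - 1) = y ^ (d - 1) := by
      rw [← Real.rpow_natCast, Nat.cast_sub hd, Nat.cast_one]
    simp only [this, Real.rpow_two]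
  have r1 := integral_fun_norm_addHaar (volume : Measure (EuclideanSpace ℝ (Fin d)))
    (fun y : ℝ => y ^ 2 * Real.exp (-b * y ^ 2))
  have r2 := integral_fun_norm_addHaar (volume : Measure (EuclideanSpace ℝ (Fin d)))
    (fun y : ℝ => Real.exp (-b * y ^ 2))
  simp only [finrank_euclideanSpace, Fintype.card_fin, smul_eq_mul, nsmul_eq_mul] at r1 r2
  rw [r1, r2, e1, e2, k, k']
  have g : Real.Gamma (((d : ℝ) + 1 + 1) / 2) = d / 2 * Real.Gamma (d / 2) := by
    rw [← Real.Gamma_add_one (by positivity)]; congr 1; ring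
  have g2 : b ^ (-((d : ℝ) + 1 + 1) / 2) = b ^ (-(d : ℝ) / 2) / b := by
    rw [show -((d : ℝ) + 1 + 1) / 2 = -(d : ℝ) / 2 - 1 by ring, Real.rpow_sub_one hb.ne']
  rw [g, g2, show (d : ℝ) - 1 + 1 = d by ring]
  field_simp

/-- centered and normalized integral of an affine quadratic function. -/
lemma aux_main {β : ℝ} (hβ : 0 < β) (m v : EuclideanSpace ℝ (Fin d)) (A : ℝ) :
    Integrable (fun t => gaussPdf β m t *
      (A - ‖t - m‖ ^ 2 / (2 * β ^ 2) - inner ℝ (t - m) v)) ∧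
    ∫ t, gaussPdf β m t * (A - ‖t - m‖ ^ 2 / (2 * β ^ 2) - inner ℝ (t - m) v) = A - d / 2 := by
  set K : ℝ := (2 * π * β ^ 2) ^ (-(d : ℝ) / 2) with hK
  have hb : 0 < 1 / (2 * β ^ 2) := by positivity
  set b := 1 / (2 * β ^ 2) with hbdef
  have hcomm : (fun t => gaussPdf β m t *
      (A - ‖t - m‖ ^ 2 / (2 * β ^ 2) - inner ℝ (t - m) v)) = fun t =>
      (fun x : EuclideanSpace ℝ (Fin d) => K * A * Real.exp (-b * ‖x‖ ^ 2)
        - K * b * (‖x‖ ^ 2 * Real.exp (-b * ‖x‖ ^ 2))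
        - K * (inner ℝ x v * Real.exp (-b * ‖x‖ ^ 2))) (t - m) := by
    funext t
    have : -‖t - m‖ ^ 2 / (2 * β ^ 2) = -b * ‖t - m‖ ^ 2 := by rw [hbdef]; ring
    simp only [gaussPdf, this, ← hK]
    rw [hbdef]; ring
  have i0 := (aux_int0 (d := d) hb).const_mul (K * A)
  have i2 := (aux_int2 (d := d) hb).const_mul (K * b)
  have i1 := (aux_int1 (d := d) hb v).const_mul K
  rw [hcomm]
  refine ⟨((i0.sub i2).sub i1).comp_sub_right m, ?_⟩
  rw [integral_sub_right_eq_self (fun x : EuclideanSpace ℝ (Fin d) =>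
        K * A * Real.exp (-b * ‖x‖ ^ 2)
        - K * b * (‖x‖ ^ 2 * Real.exp (-b * ‖x‖ ^ 2))
        - K * (inner ℝ x v * Real.exp (-b * ‖x‖ ^ 2))) m,
    integral_sub (by exact i0.sub i2) i1, integral_sub i0 i2]
  simp only [integral_const_mul]
  rw [aux_val1, aux_val2 hb, GaussianFourier.integral_rexp_neg_mul_sq_norm hb]
  have hn : K * (π / b) ^ ((Module.finrank ℝ (EuclideanSpace ℝ (Fin d)) : ℝ) / 2) = 1 := by
    rw [finrank_euclideanSpace, Fintype.card_fin, hK, neg_div, Real.rpow_neg (by positivity),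
      show π / b = 2 * π * β ^ 2 by rw [hbdef]; field_simp]
    exact inv_mul_cancel₀ (by positivity)
  set R := (π / b) ^ ((Module.finrank ℝ (EuclideanSpace ℝ (Fin d)) : ℝ) / 2)
  have : K * A * R - K * b * (d / 2 / b * R) - K * 0 = (K * R) * (A - d / 2) := by
    field_simp; ring
  rw [this, hn, one_mul]

end helpers

/-- Kolchinsky–Tracy upper bound via KL divergence:
`h(C+Z) ≤ (d/2)log(2πeβ²) − Σ_i c_i log(Σ_j c_j exp(−‖μ_i − μ_j‖²/(2β²)))`. -/
theorem diffEnt_mixture_le_kl {d n : ℕ} (β : ℝ) (hβ : 0 < β)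
    (c : Fin n → ℝ) (hc : ∀ i, 0 ≤ c i) (hsum : ∑ i, c i = 1)
    (μ : Fin n → EuclideanSpace ℝ (Fin d)) :
    diffEnt (fun t => ∑ i, c i * gaussPdf β (μ i) t) ≤
      (d : ℝ) / 2 * Real.log (2 * π * Real.exp 1 * β ^ 2) -
        ∑ i, c i * Real.log (∑ j, c j * Real.exp (-‖μ i - μ j‖ ^ 2 / (2 * β ^ 2))) := by
  obtain ⟨i0, hi0⟩ : ∃ i, 0 < c i := by
    by_contra! h
    have := Finset.sum_nonpos (s := Finset.univ) (fun i _ => h i)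
    linarith
  have hpos : ∀ f : Fin n → ℝ, (∀ j, 0 < f j) → 0 < ∑ j, c j * f j := fun f hf =>
    Finset.sum_pos' (fun j _ => mul_nonneg (hc j) (hf j).le)
      ⟨i0, Finset.mem_univ _, mul_pos hi0 (hf i0)⟩
  set K : ℝ := (2 * π * β ^ 2) ^ (-(d : ℝ) / 2) with hK
  have hKpos : 0 < K := by positivity
  set S : Fin n → ℝ := fun i => ∑ j, c j * Real.exp (-‖μ i - μ j‖ ^ 2 / (2 * β ^ 2)) with hS
  have hSpos : ∀ i, 0 < S i := fun i => hpos _ fun j => Real.exp_pos _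
  set g : EuclideanSpace ℝ (Fin d) → ℝ := fun t => ∑ i, c i * gaussPdf β (μ i) t with hg
  have hγpos : ∀ m t, 0 < gaussPdf (d := d) β m t := fun m t => by
    unfold gaussPdf; positivity
  have hgpos : ∀ t, 0 < g t := fun t => hpos _ fun j => hγpos _ _
  have hgle : ∀ t, g t ≤ K := fun t => by
    calc g t ≤ ∑ i, c i * K := by
          refine Finset.sum_le_sum fun i _ => mul_le_mul_of_nonneg_left ?_ (hc i)
          unfold gaussPdf
          refine mul_le_of_le_one_right hKpos.le (Real.exp_le_one_iff.2 ?_)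
          rw [neg_div]
          exact neg_nonpos.2 (by positivity)
      _ = K := by rw [← Finset.sum_mul, hsum, one_mul]
  have hgmeas : Measurable g := by
    simp only [hg, gaussPdf]; fun_prop
  set w : Fin n → Fin n → ℝ := fun i j =>
    c j * Real.exp (-‖μ i - μ j‖ ^ 2 / (2 * β ^ 2)) / S i with hw
  set v : Fin n → EuclideanSpace ℝ (Fin d) := fun i =>
    ∑ j, w i j • ((1 / β ^ 2) • (μ i - μ j)) with hv
  have hlow : ∀ i t, (Real.log (S i) + Real.log K) - ‖t - μ i‖ ^ 2 / (2 * β ^ 2)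
      - inner ℝ (t - μ i) (v i) ≤ Real.log (g t) := by
    intro i t
    rw [Real.le_log_iff_exp_le (hgpos t)]
    have hj := convexOn_exp.map_sum_le (t := Finset.univ) (w := w i)
      (p := fun j => - inner ℝ (t - μ i) ((1 / β ^ 2) • (μ i - μ j)))
      (fun j _ => div_nonneg (mul_nonneg (hc j) (Real.exp_pos _).le) (hSpos i).le)
      (by simp only [hw]; rw [← Finset.sum_div]; exact div_self (hSpos i).ne')
      (fun j _ => Set.mem_univ _)
    have hin : ∑ j, w i j • (- inner ℝ (t - μ i) ((1 / β ^ 2) • (μ i - μ j)))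
        = - inner ℝ (t - μ i) (v i) := by
      simp only [hv, inner_sum, inner_smul_right, smul_eq_mul, mul_neg, Finset.sum_neg_distrib]
    rw [hin] at hj
    have hgt : g t = S i * K * Real.exp (-(‖t - μ i‖ ^ 2 / (2 * β ^ 2))) *
        ∑ j, w i j • Real.exp (- inner ℝ (t - μ i) ((1 / β ^ 2) • (μ i - μ j))) := by
      simp only [hg]
      rw [Finset.mul_sum]
      refine Finset.sum_congr rfl fun j _ => ?_
      have he : -‖t - μ j‖ ^ 2 / (2 * β ^ 2) = -(‖t - μ i‖ ^ 2 / (2 * β ^ 2)) +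
          -‖μ i - μ j‖ ^ 2 / (2 * β ^ 2) + - inner ℝ (t - μ i) ((1 / β ^ 2) • (μ i - μ j)) := by
        rw [show t - μ j = (t - μ i) + (μ i - μ j) by abel, norm_add_sq_real, inner_smul_right]
        field_simp; ring
      simp only [gaussPdf, ← hK, hw, smul_eq_mul]
      rw [he, Real.exp_add, Real.exp_add]
      have := (hSpos i).ne'
      field_simp
    rw [hgt, sub_eq_add_neg, sub_eq_add_neg, Real.exp_add, Real.exp_add, Real.exp_add,
      Real.exp_log (hSpos i), Real.exp_log hKpos]
    exact mul_le_mul_of_nonneg_left hj (by have := hSpos i; positivity)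
  have hlogle : ∀ t, Real.log (g t) ≤ Real.log K := fun t => Real.log_le_log (hgpos t) (hgle t)
  have hIntg : ∀ i, Integrable (fun t => gaussPdf β (μ i) t * Real.log (g t)) := by
    intro i
    have a := (aux_main hβ (μ i) (v i) (Real.log (S i) + Real.log K)).1
    have b : Integrable (fun t => gaussPdf β (μ i) t * Real.log K) := by
      have h0 : Integrable (fun x : EuclideanSpace ℝ (Fin d) => K * Real.log K *
          Real.exp (-(1 / (2 * β ^ 2)) * ‖x‖ ^ 2)) :=
        (aux_int0 (by positivity)).const_mul _
      refine (h0.comp_sub_right (μ i)).congr (Filter.Eventually.of_forall fun t => ?_)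
      simp only [gaussPdf, ← hK]
      rw [show -‖t - μ i‖ ^ 2 / (2 * β ^ 2) = -(1 / (2 * β ^ 2)) * ‖t - μ i‖ ^ 2 by ring]
      ring
    refine (a.abs.add b.abs).mono' ?_ (Filter.Eventually.of_forall fun t => ?_)
    · refine Measurable.aestronglyMeasurable ?_
      refine Measurable.mul ?_ (Real.measurable_log.comp hgmeas)
      unfold gaussPdf; fun_prop
    · have h1 := mul_le_mul_of_nonneg_left (hlow i t) (hγpos (μ i) t).le
      have h2 := mul_le_mul_of_nonneg_left (hlogle t) (hγpos (μ i) t).le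
      rw [Real.norm_eq_abs]
      exact (abs_le_max_abs_abs h1 h2).trans
        (max_le_add_of_nonneg (abs_nonneg _) (abs_nonneg _))
  have hlogs : Real.log K - d / 2 = -((d : ℝ) / 2 * Real.log (2 * π * Real.exp 1 * β ^ 2)) := by
    rw [hK, Real.log_rpow (by positivity),
      show 2 * π * Real.exp 1 * β ^ 2 = (2 * π * β ^ 2) * Real.exp 1 by ring,
      Real.log_mul (x := 2 * π * β ^ 2) (y := Real.exp 1) (by positivity) (by positivity),
      Real.log_exp]
    ring
  have hbound : ∀ i, Real.log (S i) - (d : ℝ) / 2 * Real.log (2 * π * Real.exp 1 * β ^ 2) ≤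
      ∫ t, gaussPdf β (μ i) t * Real.log (g t) := by
    intro i
    obtain ⟨a, a'⟩ := aux_main hβ (μ i) (v i) (Real.log (S i) + Real.log K)
    have := integral_mono a (hIntg i)
      (fun t => mul_le_mul_of_nonneg_left (hlow i t) (hγpos (μ i) t).le)
    rw [a'] at this
    linarith
  have hent : ∫ t, g t * Real.log (g t) =
      ∑ i, c i * ∫ t, gaussPdf β (μ i) t * Real.log (g t) := by
    simp only [← integral_const_mul]
    rw [← integral_finsetSum _ (fun i _ => (hIntg i).const_mul (c i))]
    refine integral_congr_ae (Filter.Eventually.of_forall fun t => ?_)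
    simp only [← mul_assoc]
    rw [← Finset.sum_mul]
  have hfin := Finset.sum_le_sum (s := Finset.univ)
    (fun i _ => mul_le_mul_of_nonneg_left (hbound i) (hc i))
  simp only [mul_sub, Finset.sum_sub_distrib, ← Finset.sum_mul, hsum, one_mul] at hfin
  unfold diffEnt
  rw [hent]
  linarith
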